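/- Fix n ∈ ℕ. Let (w_i)_{i∈ℤ} be a biinfinite sequence of biinfinite binary words and v : ℤ → {n, n+1, n+2} a labelling such that w_i T_{v(i)} w_{i+1} for every i ∈ ℤ. Then: (i) for every i with v(i) = n, one has v(i−1) = n+1 and v(i+1) = n+1 (every occurrence of T_n is bordered above and below by T_{n+1}); and (ii) there is no i with (v(i), v(i+1), v(i+2), v(i+3), v(i+4)) = (n+1, n, n+1, n, n+1). Consequently, replacing every block T_{n+1} T_n T_{n+1} by T_{n+3} rewrites the sequence as a composition of T_{n+1}, T_{n+2}, T_{n+3} only. -/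

import Mathlib

structure WangTile (H V : Type*) where
  west : H
  east : H
  south : V
  north : V
deriving DecidableEq

def TilingOn {H V : Type*} (T : Set (WangTile H V)) (X : Set (ℤ × ℤ))
    (f : ℤ × ℤ → WangTile H V) : Prop :=
  (∀ p ∈ X, f p ∈ T) ∧
  (∀ x y : ℤ, (x, y) ∈ X → (x + 1, y) ∈ X →
    (f (x, y)).east = (f (x + 1, y)).west) ∧
  (∀ x y : ℤ, (x, y) ∈ X → (x, y + 1) ∈ X →
    (f (x, y)).north = (f (x, y + 1)).south)

def Tiling {H V : Type*} (T : Set (WangTile H V)) (f : ℤ × ℤ → WangTile H V) : Prop :=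
  TilingOn T Set.univ f

def TilesPlane {H V : Type*} (T : Set (WangTile H V)) : Prop :=
  ∃ f, Tiling T f

def PeriodicTiling {H V : Type*} (f : ℤ × ℤ → WangTile H V) : Prop :=
  ∃ u v : ℤ, (u, v) ≠ (0, 0) ∧ ∀ x y : ℤ, f (x + u, y + v) = f (x, y)

def Aperiodic {H V : Type*} (T : Set (WangTile H V)) : Prop :=
  TilesPlane T ∧ ∀ f, Tiling T f → ¬ PeriodicTiling f

def MinimallyAperiodic {H V : Type*} (T : Set (WangTile H V)) : Prop :=
  Aperiodic T ∧ ∀ S : Set (WangTile H V), S ⊂ T → ¬ TilesPlane S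

/-- `fg n` is the `(n+1)`-th Fibonacci number: `fg 0 = 1`, `fg 1 = 2`,
`fg (n+2) = fg n + fg (n+1)`. -/
def fg : ℕ → ℕ
  | 0 => 1
  | 1 => 2
  | n + 2 => fg n + fg (n + 1)

/-- A word-transition of a two-state transducer: a source state, a target state
(`false` = state 0, `true` = state 5), a read word and a write word over `{0,1}`. -/
structure WTrans where
  src : Bool
  tgt : Bool
  read : List (Fin 2)
  write : List (Fin 2)

/-- `0^k` resp. `1^k` as lists over `Fin 2`. -/
def rep (k : ℕ) (d : Fin 2) : List (Fin 2) := List.replicate k d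

/-- The word-transitions of the transducer `T_n` of the paper: a single transition from
state 0 to state 5 and five transitions from state 5 back to state 0, depending on the
parity of `n`. -/
def TTrans (n : ℕ) : Set WTrans :=
  if n % 2 = 0 then
    { ⟨false, true, rep (fg (n + 2) - 3) 0, rep (fg (n + 2) - 3) 1⟩,
      ⟨true, false, rep (fg (n + 1) + 3) 0, [1, 0, 0] ++ rep (fg (n + 1)) 1⟩,
      ⟨true, false, rep (fg (n + 3) + 3) 0,
        rep (fg (n + 2)) 1 ++ [0, 0, 0] ++ rep (fg (n + 1)) 1⟩,
      ⟨true, false, rep (fg (n + 1)) 0 ++ [1, 1, 1] ++ rep (fg (n + 2)) 0,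
        rep (fg (n + 3) + 3) 1⟩,
      ⟨true, false, rep (fg (n + 1)) 0 ++ [1, 1, 0], rep (fg (n + 1) + 3) 1⟩,
      ⟨true, false, rep (fg (n + 3)) 0 ++ [1, 1, 0] ++ rep (fg (n + 1)) 0,
        rep (fg (n + 1)) 1 ++ [1, 0, 0] ++ rep (fg (n + 3)) 1⟩ }
  else
    { ⟨false, true, rep (fg (n + 2) - 3) 1, rep (fg (n + 2) - 3) 0⟩,
      ⟨true, false, rep (fg (n + 1) + 3) 1, [1, 1, 0] ++ rep (fg (n + 1)) 0⟩,
      ⟨true, false, rep (fg (n + 3) + 3) 1,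
        rep (fg (n + 2)) 0 ++ [1, 1, 1] ++ rep (fg (n + 1)) 0⟩,
      ⟨true, false, rep (fg (n + 1)) 1 ++ [0, 0, 0] ++ rep (fg (n + 2)) 1,
        rep (fg (n + 3) + 3) 0⟩,
      ⟨true, false, rep (fg (n + 1)) 1 ++ [1, 0, 0], rep (fg (n + 1) + 3) 0⟩,
      ⟨true, false, rep (fg (n + 3)) 1 ++ [1, 0, 0] ++ rep (fg (n + 1)) 1,
        rep (fg (n + 1)) 0 ++ [1, 1, 0] ++ rep (fg (n + 3)) 0⟩ }

/-- The relation `u T_n v` on biinfinite binary words: there are cut positions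
`p : ℤ → ℤ`, strictly increasing and tending to `±∞`, and a choice `c : ℤ → WTrans` of
word-transitions of `T_n`, consecutively composable in the state graph, such that on
each interval `[p k, p (k+1))` the word `u` spells the read word and `v` spells the
write word of the chosen transition. -/
def TRel (n : ℕ) (u v : ℤ → Fin 2) : Prop :=
  ∃ (p : ℤ → ℤ) (c : ℤ → WTrans),
    StrictMono p ∧
    Filter.Tendsto p Filter.atTop Filter.atTop ∧
    Filter.Tendsto p Filter.atBot Filter.atBot ∧
    (∀ k : ℤ, c k ∈ TTrans n) ∧
    (∀ k : ℤ, (c k).tgt = (c (k + 1)).src) ∧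
    (∀ k : ℤ, p (k + 1) = p k + (c k).read.length) ∧
    (∀ (k : ℤ) (i : ℕ), i < (c k).read.length → u (p k + i) = (c k).read.getD i 0) ∧
    (∀ (k : ℤ) (i : ℕ), i < (c k).write.length → v (p k + i) = (c k).write.getD i 0)


/-- Indicator of the minority letter at `x`: letter `1` in mode `false`, letter `0` in mode `true`. -/
def cntM (s : Bool) (u : ℤ → Fin 2) (x : ℤ) : ℤ :=
  if s then (if u x = 0 then 1 else 0) else (if u x = 1 then 1 else 0)

/-- Indicator of a descent `10`. -/
def cntK (s : Bool) (u : ℤ → Fin 2) (x : ℤ) : ℤ :=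
  if s then (if u (x - 1) = 1 ∧ u x = 0 then 1 else 0)
  else (if u x = 1 ∧ u (x + 1) = 0 then 1 else 0)

/-- Indicator of three consecutive minority letters. -/
def cntH (s : Bool) (u : ℤ → Fin 2) (x : ℤ) : ℤ :=
  if s then (if u x = 0 ∧ u (x - 1) = 0 ∧ u (x - 2) = 0 then 1 else 0)
  else (if u x = 1 ∧ u (x + 1) = 1 ∧ u (x + 2) = 1 then 1 else 0)

/-- `u` spells `w` from position `p`. -/
def Spell (u : ℤ → Fin 2) (p : ℤ) (w : List (Fin 2)) : Prop :=
  ∀ i : ℕ, i < w.length → u (p + i) = w.getD i 0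

/-- The three statistics summed over a block. -/
def Stat (s : Bool) (u : ℤ → Fin 2) (p L m k h : ℤ) : Prop :=
  ∑ x ∈ Finset.Ico p (p + L), cntM s u x = m ∧
  ∑ x ∈ Finset.Ico p (p + L), cntK s u x = k ∧
  ∑ x ∈ Finset.Ico p (p + L), cntH s u x = h

lemma fin2_ne (y : Fin 2) : y ≠ 0 ↔ y = 1 := by omega

lemma spell_none {u : ℤ → Fin 2} {p : ℤ} {L : ℕ} {d : Fin 2} (h : Spell u p (rep L d)) :
    ∀ x, p ≤ x → x < p + L → u x = d := by
  intro x h1 h2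
  obtain ⟨i, rfl⟩ : ∃ i : ℕ, x = p + i := ⟨(x - p).toNat, by omega⟩
  have hi : i < L := by omega
  have := h i (by simpa [rep] using hi)
  rw [this]
  simp [rep, List.getD_eq_getElem?_getD, hi]

lemma spell_mark {u : ℤ → Fin 2} {p : ℤ} {i j : ℕ} {d a b c : Fin 2}
    (h : Spell u p (rep i d ++ [a, b, c] ++ rep j d)) :
    ∀ x, p ≤ x → x < p + ((i + 3 + j : ℕ) : ℤ) →
      u x = if x = p + i then a else if x = p + i + 1 then b else
        if x = p + i + 2 then c else d := by
  intro x h1 h2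
  obtain ⟨t, rfl⟩ : ∃ t : ℕ, x = p + t := ⟨(x - p).toNat, by omega⟩
  have ht : t < i + 3 + j := by omega
  have := h t (by simp [rep]; omega)
  rw [this]
  simp only [rep, List.getD_eq_getElem?_getD, List.append_assoc]
  rcases lt_or_ge t i with hlt | hge
  · rw [List.getElem?_append_left (by simpa using hlt)]
    rw [if_neg (by omega), if_neg (by omega), if_neg (by omega)]
    simp [hlt]
  · rw [List.getElem?_append_right (by simpa using hge)]
    simp only [List.length_replicate]
    obtain ⟨r, rfl⟩ : ∃ r, t = i + r := ⟨t - i, by omega⟩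
    rw [Nat.add_sub_cancel_left]
    match r, ht with
    | 0, _ => simp
    | 1, _ =>
      rw [if_neg (by omega), if_pos (by push_cast; omega)]; simp
    | 2, _ =>
      rw [if_neg (by omega), if_neg (by omega), if_pos (by push_cast; omega)]; simp
    | r + 3, ht =>
      rw [if_neg (by omega), if_neg (by omega), if_neg (by omega)]
      have : r < j := by omega
      simp [this]

lemma sum_one {p L q : ℤ} {f : ℤ → ℤ} (h1 : p ≤ q) (h2 : q < p + L)
    (hf : ∀ x, p ≤ x → x < p + L → f x = if x = q then 1 else 0) :
    ∑ x ∈ Finset.Ico p (p + L), f x = 1 := by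
  rw [Finset.sum_congr rfl (g := fun x => if x = q then 1 else 0)]
  · rw [Finset.sum_ite_eq', if_pos (by simp; omega)]
  · intro x hx
    rw [Finset.mem_Ico] at hx
    exact hf x hx.1 hx.2

lemma sum_zero {p L : ℤ} {f : ℤ → ℤ} (hf : ∀ x, p ≤ x → x < p + L → f x = 0) :
    ∑ x ∈ Finset.Ico p (p + L), f x = 0 := by
  apply Finset.sum_eq_zero
  intro x hx
  rw [Finset.mem_Ico] at hx
  exact hf x hx.1 hx.2

lemma sum_two {p L q : ℤ} {f : ℤ → ℤ} (h1 : p ≤ q) (h2 : q + 1 < p + L)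
    (hf : ∀ x, p ≤ x → x < p + L → f x = if x = q ∨ x = q + 1 then 1 else 0) :
    ∑ x ∈ Finset.Ico p (p + L), f x = 2 := by
  have e1 := sum_one (p := p) (L := L) (q := q) (f := fun x => if x = q then 1 else 0)
    h1 (by omega) (fun _ _ _ => rfl)
  have e2 := sum_one (p := p) (L := L) (q := q + 1) (f := fun x => if x = q + 1 then 1 else 0)
    (by omega) (by omega) (fun _ _ _ => rfl)
  rw [Finset.sum_congr rfl
    (g := fun x => (if x = q then (1 : ℤ) else 0) + (if x = q + 1 then 1 else 0))]
  · rw [Finset.sum_add_distrib, e1, e2]; norm_num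
  · intro x hx
    rw [Finset.mem_Ico] at hx
    rw [hf x hx.1 hx.2]
    split_ifs <;> omega

lemma sum_three {p L q : ℤ} {f : ℤ → ℤ} (h1 : p ≤ q) (h2 : q + 2 < p + L)
    (hf : ∀ x, p ≤ x → x < p + L → f x = if x = q ∨ x = q + 1 ∨ x = q + 2 then 1 else 0) :
    ∑ x ∈ Finset.Ico p (p + L), f x = 3 := by
  have e1 := sum_one (p := p) (L := L) (q := q) (f := fun x => if x = q then 1 else 0)
    h1 (by omega) (fun _ _ _ => rfl)
  have e2 := sum_two (p := p) (L := L) (q := q + 1)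
    (f := fun x => if x = q + 1 ∨ x = q + 1 + 1 then 1 else 0)
    (by omega) (by omega) (fun _ _ _ => rfl)
  rw [Finset.sum_congr rfl
    (g := fun x => (if x = q then (1 : ℤ) else 0) +
      (if x = q + 1 ∨ x = q + 1 + 1 then 1 else 0))]
  · rw [Finset.sum_add_distrib, e1, e2]; norm_num
  · intro x hx
    rw [Finset.mem_Ico] at hx
    rw [hf x hx.1 hx.2]
    split_ifs <;> omega

lemma stat0_none {u : ℤ → Fin 2} {p : ℤ} {L : ℕ} (h : Spell u p (rep L 0)) :
    Stat false u p L 0 0 0 := by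
  have hu := spell_none h
  refine ⟨sum_zero ?_, sum_zero ?_, sum_zero ?_⟩ <;>
  · intro x h1 h2
    simp [cntM, cntK, cntH, hu x h1 h2]

lemma stat1_none {u : ℤ → Fin 2} {p : ℤ} {L : ℕ} (h : Spell u p (rep L 1)) :
    Stat true u p L 0 0 0 := by
  have hu := spell_none h
  refine ⟨sum_zero ?_, sum_zero ?_, sum_zero ?_⟩ <;>
  · intro x h1 h2
    simp [cntM, cntK, cntH, hu x h1 h2]

lemma stat0_D {u : ℤ → Fin 2} {p : ℤ} {i j : ℕ}
    (h : Spell u p (rep i 0 ++ [1, 1, 0] ++ rep j 0)) :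
    Stat false u p ((i + 3 + j : ℕ) : ℤ) 2 1 0 := by
  have hu := spell_mark h
  refine ⟨sum_two (q := p + i) (by omega) (by omega) ?_,
    sum_one (q := p + i + 1) (by omega) (by omega) ?_, sum_zero ?_⟩ <;>
  · intro x h1 h2
    have e0 := hu x h1 h2
    have e1 := hu (x + 1)
    have e2 := hu (x + 2)
    simp only [cntM, cntK, cntH]
    grind

lemma stat0_H {u : ℤ → Fin 2} {p : ℤ} {i j : ℕ} (hj : 0 < j)
    (h : Spell u p (rep i 0 ++ [1, 1, 1] ++ rep j 0)) :
    Stat false u p ((i + 3 + j : ℕ) : ℤ) 3 1 1 := by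
  have hu := spell_mark h
  refine ⟨sum_three (q := p + i) (by omega) (by omega) ?_,
    sum_one (q := p + i + 2) (by omega) (by omega) ?_,
    sum_one (q := p + i) (by omega) (by omega) ?_⟩ <;>
  · intro x h1 h2
    have e0 := hu x h1 h2
    have e1 := hu (x + 1)
    have e2 := hu (x + 2)
    simp only [cntM, cntK, cntH]
    grind

lemma stat1_D {u : ℤ → Fin 2} {p : ℤ} {i j : ℕ}
    (h : Spell u p (rep i 1 ++ [1, 0, 0] ++ rep j 1)) :
    Stat true u p ((i + 3 + j : ℕ) : ℤ) 2 1 0 := by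
  have hu := spell_mark h
  refine ⟨sum_two (q := p + i + 1) (by omega) (by omega) ?_,
    sum_one (q := p + i + 1) (by omega) (by omega) ?_, sum_zero ?_⟩ <;>
  · intro x h1 h2
    have e0 := hu x h1 h2
    have e1 := hu (x - 1)
    have e2 := hu (x - 2)
    simp only [cntM, cntK, cntH]
    grind

lemma stat1_H {u : ℤ → Fin 2} {p : ℤ} {i j : ℕ} (hi : 0 < i)
    (h : Spell u p (rep i 1 ++ [0, 0, 0] ++ rep j 1)) :
    Stat true u p ((i + 3 + j : ℕ) : ℤ) 3 1 1 := by
  have hu := spell_mark h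
  refine ⟨sum_three (q := p + i) (by omega) (by omega) ?_,
    sum_one (q := p + i) (by omega) (by omega) ?_,
    sum_one (q := p + i + 2) (by omega) (by omega) ?_⟩ <;>
  · intro x h1 h2
    have e0 := hu x h1 h2
    have e1 := hu (x - 1)
    have e2 := hu (x - 2)
    simp only [cntM, cntK, cntH]
    grind

/-- The mode of the word read by `T_n`. -/
def md (n : ℕ) : Bool := decide (n % 2 = 1)

/-- What a transition of `T_n` contributes. -/
def Contrib (n : ℕ) (c : WTrans) (u v : ℤ → Fin 2) (p : ℤ) : Prop :=
  ∃ m k h m' k' h' : ℤ,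
    Stat (md n) u p c.read.length m k h ∧ Stat (!md n) v p c.read.length m' k' h' ∧
    ((c.src = false ∧ c.tgt = true ∧ c.read.length = fg (n + 2) - 3 ∧
        m = 0 ∧ k = 0 ∧ h = 0 ∧ m' = 0 ∧ k' = 0 ∧ h' = 0) ∨
     (c.src = true ∧ c.tgt = false ∧
      ((c.read.length = fg (n + 1) + 3 ∧ m + m' = 2 ∧ k + k' = 1 ∧ h + h' = 0) ∨
       (c.read.length = fg (n + 3) + 3 ∧ m + m' = 3 ∧ k + k' = 1 ∧ h + h' = 1) ∨
       (c.read.length = fg (n + 3) + fg (n + 1) + 3 ∧ m + m' = 4 ∧ k + k' = 2 ∧ h + h' = 0))))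

lemma fg_pos (n : ℕ) : 0 < fg n := by
  induction n using Nat.strong_induction_on with
  | _ n ih =>
    match n with
    | 0 => simp [fg]
    | 1 => simp [fg]
    | n + 2 => have := ih n (by omega); simp only [fg]; omega

lemma fg_add (n : ℕ) : fg (n + 2) = fg n + fg (n + 1) := rfl

lemma fg_lt (n : ℕ) : fg n < fg (n + 1) := by
  cases n with
  | zero => simp [fg]
  | succ n =>
    have := fg_pos n
    change fg (n + 1) < fg n + fg (n + 1)
    omega

lemma contrib {n : ℕ} {c : WTrans} {u v : ℤ → Fin 2} {p : ℤ} (hc : c ∈ TTrans n)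
    (hu : Spell u p c.read) (hv : Spell v p c.write) : Contrib n c u v p := by
  have e3 : fg (n + 3) = fg (n + 1) + fg (n + 2) := rfl
  have p1 := fg_pos (n + 1)
  have p2 := fg_pos (n + 2)
  have key : ∀ {s : Bool} {w : ℤ → Fin 2} {L L' : ℕ} {m k h : ℤ}, Stat s w p L m k h → L = L' →
    Stat s w p L' m k h := by
    rintro s w L L' m k h hs rfl; exact hs
  unfold TTrans at hc
  split_ifs at hc with hn
  · have hm : md n = false := by simp [md, hn]
    simp only [Set.mem_insert_iff, Set.mem_singleton_iff] at hc
    unfold Contrib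
    rw [hm]
    rcases hc with rfl | rfl | rfl | rfl | rfl | rfl
    · exact ⟨_, _, _, _, _, _, key (stat0_none hu) (by simp [rep]),
        key (stat1_none hv) (by simp [rep]), Or.inl (by simp [rep])⟩
    · exact ⟨_, _, _, _, _, _, key (stat0_none hu) (by simp [rep]),
        key (stat1_D (i := 0) hv) (by simp [rep]; omega), Or.inr (by simp [rep])⟩
    · exact ⟨_, _, _, _, _, _, key (stat0_none hu) (by simp [rep]),
        key (stat1_H p2 hv) (by simp [rep]; omega), Or.inr (by simp [rep])⟩
    · exact ⟨_, _, _, _, _, _, key (stat0_H p2 hu) (by simp [rep]; try omega),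
        key (stat1_none hv) (by simp [rep]; omega), Or.inr (by simp [rep]; omega)⟩
    · exact ⟨_, _, _, _, _, _, key (stat0_D (j := 0) (by simpa [rep] using hu)) (by simp [rep]),
        key (stat1_none hv) (by simp [rep]), Or.inr (by simp [rep])⟩
    · exact ⟨_, _, _, _, _, _, key (stat0_D hu) (by simp [rep]; try omega),
        key (stat1_D hv) (by simp [rep]; omega), Or.inr (by simp [rep]; omega)⟩
  · have hm : md n = true := by simp [md]; omega
    simp only [Set.mem_insert_iff, Set.mem_singleton_iff] at hc
    unfold Contrib
    rw [hm]
    rcases hc with rfl | rfl | rfl | rfl | rfl | rfl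
    · exact ⟨_, _, _, _, _, _, key (stat1_none hu) (by simp [rep]),
        key (stat0_none hv) (by simp [rep]), Or.inl (by simp [rep])⟩
    · exact ⟨_, _, _, _, _, _, key (stat1_none hu) (by simp [rep]),
        key (stat0_D (i := 0) hv) (by simp [rep]; omega), Or.inr (by simp [rep])⟩
    · exact ⟨_, _, _, _, _, _, key (stat1_none hu) (by simp [rep]),
        key (stat0_H p1 hv) (by simp [rep]; omega), Or.inr (by simp [rep])⟩
    · exact ⟨_, _, _, _, _, _, key (stat1_H p1 hu) (by simp [rep]; try omega),
        key (stat0_none hv) (by simp [rep]; omega), Or.inr (by simp [rep]; omega)⟩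
    · exact ⟨_, _, _, _, _, _, key (stat1_D (j := 0) (by simpa [rep] using hu)) (by simp [rep]),
        key (stat0_none hv) (by simp [rep]), Or.inr (by simp [rep])⟩
    · exact ⟨_, _, _, _, _, _, key (stat1_D hu) (by simp [rep]; try omega),
        key (stat0_D hv) (by simp [rep]; omega), Or.inr (by simp [rep]; omega)⟩

lemma abs_sum_Ico_le {g : ℤ → ℤ} {B : ℤ} (hB : ∀ x, |g x| ≤ B) (a b : ℤ) (hab : a ≤ b) :
    |∑ x ∈ Finset.Ico a b, g x| ≤ B * (b - a) := by
  calc |∑ x ∈ Finset.Ico a b, g x| ≤ ∑ x ∈ Finset.Ico a b, |g x| := Finset.abs_sum_le_sum_abs _ _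
    _ ≤ ∑ x ∈ Finset.Ico a b, B := Finset.sum_le_sum fun x _ => hB x
    _ = B * (b - a) := by
      rw [Finset.sum_const, Int.card_Ico, nsmul_eq_mul, Int.toNat_of_nonneg (by omega), mul_comm]

lemma sum_Ico_split (g : ℤ → ℤ) {a b c : ℤ} (h1 : a ≤ b) (h2 : b ≤ c) :
    ∑ x ∈ Finset.Ico a c, g x = ∑ x ∈ Finset.Ico a b, g x + ∑ x ∈ Finset.Ico b c, g x := by
  rw [← Finset.Ico_union_Ico_eq_Ico h1 h2,
    Finset.sum_union (Finset.Ico_disjoint_Ico_consecutive a b c)]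

lemma tele {p : ℤ → ℤ} (hp : StrictMono p) (hbot : Filter.Tendsto p Filter.atBot Filter.atBot)
    {g ψ : ℤ → ℤ} {B M Q : ℤ} (hB : ∀ x, |g x| ≤ B) (hM : ∀ k, p (k + 1) ≤ p k + M)
    (hQ : ∀ k, |ψ k| ≤ Q)
    (hs : ∀ k, ∑ x ∈ Finset.Ico (p k) (p (k + 1)), g x ≤ ψ (k + 1) - ψ k) :
    ∃ C : ℤ, ∀ L : ℕ, ∑ x ∈ Finset.Ico 0 (L : ℤ), g x ≤ C := by
  obtain ⟨k0, hk0⟩ := (hbot.eventually (Filter.eventually_le_atBot 0)).exists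
  have hB0 : 0 ≤ B := (abs_nonneg _).trans (hB 0)
  have hM0 : 0 ≤ M := by have := hM 0; have := hp (show (0 : ℤ) < 0 + 1 by norm_num); omega
  have hmono : ∀ j : ℕ, p k0 + j ≤ p (k0 + j) := by
    intro j
    induction j with
    | zero => simp
    | succ j ih =>
      have := hp (show k0 + (j : ℤ) < k0 + ((j + 1 : ℕ) : ℤ) by push_cast; omega)
      push_cast at *; omega
  have hsum : ∀ j : ℕ, ∑ x ∈ Finset.Ico (p k0) (p (k0 + j)), g x ≤ ψ (k0 + j) - ψ k0 := by
    intro j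
    induction j with
    | zero => simp
    | succ j ih =>
      have h := hs (k0 + j)
      have hlt := hp (show k0 + (j : ℤ) < k0 + j + 1 by omega)
      have hj := hmono j
      push_cast
      rw [← add_assoc, sum_Ico_split g (b := p (k0 + j)) (by omega) hlt.le]
      linarith
  refine ⟨2 * Q + B * (0 - p k0) + B * M, fun L => ?_⟩
  have hex : ∃ j : ℕ, (L : ℤ) ≤ p (k0 + j) :=
    ⟨(L - p k0).toNat, by have := hmono (L - p k0).toNat; omega⟩
  classical
  let j := Nat.find hex
  have hj : (L : ℤ) ≤ p (k0 + j) := Nat.find_spec hex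
  have hj' : p (k0 + j) ≤ L + M := by
    rcases Nat.eq_zero_or_pos j with h0 | h0
    · rw [h0]; simp; omega
    · have h1 : ¬ ((L : ℤ) ≤ p (k0 + ((j - 1 : ℕ) : ℤ))) :=
        Nat.find_min hex (Nat.sub_lt h0 one_pos)
      have h2 := hM (k0 + ((j - 1 : ℕ) : ℤ))
      rw [show k0 + ((j - 1 : ℕ) : ℤ) + 1 = k0 + j by omega] at h2
      omega
  have a1 := sum_Ico_split g (a := p k0) (b := 0) (c := p (k0 + j)) hk0 (by omega)
  have a2 := sum_Ico_split g (a := 0) (b := L) (c := p (k0 + j)) (by omega) hj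
  have a3 := abs_le.1 (abs_sum_Ico_le hB (p k0) 0 hk0)
  have a4 := abs_le.1 (abs_sum_Ico_le hB L (p (k0 + j)) hj)
  have a5 := hsum j
  have a6 := abs_le.1 (hQ k0)
  have a7 := abs_le.1 (hQ (k0 + j))
  have a8 : B * (p (k0 + j) - L) ≤ B * M := mul_le_mul_of_nonneg_left (by omega) hB0
  linarith [a3.1, a4.1, a6.1, a7.2]

lemma cntM_bd (s u x) : 0 ≤ cntM s u x ∧ cntM s u x ≤ 1 := by
  unfold cntM; split_ifs <;> simp
lemma cntK_bd (s u x) : 0 ≤ cntK s u x ∧ cntK s u x ≤ 1 := by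
  unfold cntK; split_ifs <;> simp
lemma cntH_bd (s u x) : 0 ≤ cntH s u x ∧ cntH s u x ≤ 1 := by
  unfold cntH; split_ifs <;> simp

/-- General linear counting inequality for `T_n`. -/
lemma TRel_count {n : ℕ} {u v : ℤ → Fin 2} (h : TRel n u v) (A B C E : ℤ)
    (h1 : 2 * A + B ≤ E * fg (n + 3))
    (h2 : 3 * A + B + C ≤ E * fg (n + 4)) :
    ∃ R : ℤ, ∀ L : ℕ, ∑ x ∈ Finset.Ico 0 (L : ℤ),
      (A * (cntM (md n) u x + cntM (!md n) v x) + B * (cntK (md n) u x + cntK (!md n) v x)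
        + C * (cntH (md n) u x + cntH (!md n) v x) - E) ≤ R := by
  obtain ⟨p, c, hp, -, hbot, hc, hst, hlen, hu, hv⟩ := h
  have hcon : ∀ k, Contrib n (c k) u v (p k) := fun k => contrib (hc k) (hu k) (hv k)
  have e2 : fg (n + 2) = fg n + fg (n + 1) := rfl
  have e3 : fg (n + 3) = fg (n + 1) + fg (n + 2) := rfl
  have e4 : fg (n + 4) = fg (n + 2) + fg (n + 3) := rfl
  have p0 := fg_pos n
  have p1 : 2 ≤ fg (n + 1) := by have := fg_lt n; omega
  apply tele hp hbot (ψ := fun k => if (c k).src then -E * (fg (n + 2) - 3) else 0)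
    (B := |A| * 2 + |B| * 2 + |C| * 2 + |E|)
    (M := fg (n + 3) + fg (n + 1) + 3) (Q := |E * (fg (n + 2) - 3)|)
  · intro x
    refine (abs_sub _ _).trans ?_
    gcongr
    refine (abs_add_three _ _ _).trans ?_
    rw [abs_mul, abs_mul, abs_mul]
    have b1 := cntM_bd (md n) u x
    have b2 := cntM_bd (!md n) v x
    have b3 := cntK_bd (md n) u x
    have b4 := cntK_bd (!md n) v x
    have b5 := cntH_bd (md n) u x
    have b6 := cntH_bd (!md n) v x
    gcongr <;> rw [abs_le] <;> constructor <;> omega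
  · intro k
    rw [hlen]
    obtain ⟨m, k1, h, m', k', h', -, -, hh⟩ := hcon k
    rcases hh with ⟨-, -, hh, -⟩ | ⟨-, -, ⟨hh, -⟩ | ⟨hh, -⟩ | ⟨hh, -⟩⟩ <;> omega
  · intro k
    split_ifs
    · rw [neg_mul, abs_neg]
    · rw [abs_zero]; exact abs_nonneg _
  · intro k
    rw [← hst k, hlen k]
    obtain ⟨m, k1, h, m', k', h', ⟨s1, s2, s3⟩, ⟨s4, s5, s6⟩, hh⟩ := hcon k
    rw [Finset.sum_sub_distrib, Finset.sum_add_distrib, Finset.sum_add_distrib,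
      ← Finset.mul_sum, ← Finset.mul_sum, ← Finset.mul_sum, Finset.sum_add_distrib,
      Finset.sum_add_distrib, Finset.sum_add_distrib, s1, s2, s3, s4, s5, s6,
      Finset.sum_const, Int.card_Ico, nsmul_eq_mul, Int.toNat_of_nonneg (by omega)]
    rw [e4, e3] at h2
    rw [e3] at h1
    have hb : 3 ≤ fg (n + 2) := by omega
    rcases hh with ⟨q1, q2, hh, rfl, rfl, rfl, rfl, rfl, rfl⟩ |
      ⟨q1, q2, ⟨hh, r1, r2, r3⟩ | ⟨hh, r1, r2, r3⟩ | ⟨hh, r1, r2, r3⟩⟩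
    · rw [hh, q1, q2]; push_cast [Nat.cast_sub hb]; simp; linarith
    · rw [hh, q1, q2, r1, r2, r3]; push_cast at *; simp; linarith
    · rw [hh, q1, q2, r1, r2, r3, e3]; push_cast at *; simp; linarith
    · rw [hh, q1, q2, r1, r2, r3, e3]; push_cast at *; simp; linarith

lemma md_flip {m n : ℕ} (h : m % 2 = n % 2) : md m = md n := by simp [md, h]

/-- Two transducers of the same parity cannot be composed. -/
lemma parity_obstruct {m n : ℕ} (hmn : m % 2 = n % 2) {u v w : ℤ → Fin 2}
    (h1 : TRel m u v) (h2 : TRel n v w) : False := by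
  have g3 : ∀ n, 5 ≤ fg (n + 3) ∧ 8 ≤ fg (n + 4) := by
    intro n
    induction n with
    | zero => simp [fg]
    | succ n ih =>
      have : fg (n + 5) = fg (n + 3) + fg (n + 4) := rfl
      refine ⟨?_, ?_⟩
      · rw [show n + 1 + 3 = n + 4 by omega]; omega
      · rw [show n + 1 + 4 = n + 5 by omega]; omega
  obtain ⟨R1, c1⟩ := TRel_count h1 5 0 0 2 (by have := g3 m; omega) (by have := g3 m; omega)
  obtain ⟨R2, c2⟩ := TRel_count h2 5 0 0 2 (by have := g3 n; omega) (by have := g3 n; omega)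
  rw [md_flip hmn] at c1
  let L : ℕ := (R1 + R2 + 1).toNat
  have d1 := c1 L
  have d2 := c2 L
  have : ∑ x ∈ Finset.Ico 0 (L : ℤ), (1 : ℤ) ≤ R1 + R2 := by
    refine le_trans ?_ (add_le_add d1 d2)
    rw [← Finset.sum_add_distrib]
    apply Finset.sum_le_sum
    intro x _
    have b1 := cntM_bd (md n) u x
    have b2 := cntM_bd (!md n) w x
    have : cntM (md n) v x + cntM (!md n) v x = 1 := by
      unfold cntM
      rcases md n <;> rcases (show v x = 0 ∨ v x = 1 by omega) with h | h <;> simp [h]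
    linarith [b1.1, b2.1]
  rw [Finset.sum_const, Int.card_Ico, nsmul_eq_mul] at this
  simp only [L] at this
  omega

/-- Sums of the local statistics. -/
lemma pattern_obstruct {n : ℕ} {w0 w1 w2 w3 w4 w5 : ℤ → Fin 2}
    (h0 : TRel (n + 1) w0 w1) (h1 : TRel n w1 w2) (h2 : TRel (n + 1) w2 w3)
    (h3 : TRel n w3 w4) (h4 : TRel (n + 1) w4 w5) : False := by
  have e2 : fg (n + 2) = fg n + fg (n + 1) := rfl
  have e3 : fg (n + 3) = fg (n + 1) + fg (n + 2) := rfl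
  have e4 : fg (n + 4) = fg (n + 2) + fg (n + 3) := rfl
  have e5 : fg (n + 5) = fg (n + 3) + fg (n + 4) := rfl
  have p0 := fg_pos n
  have p1 := fg_pos (n + 1)
  have lt01 := fg_lt n
  have hmd : md (n + 1) = !md n := by
    unfold md; rcases Nat.mod_two_eq_zero_or_one n with h | h <;> simp [Nat.add_mod, h]
  have a1 : 2 * (0 : ℤ) + fg (n + 4) ≤ 1 * fg (n + 4) := by omega
  have a2 : 3 * (0 : ℤ) + fg (n + 4) + fg (n + 3) ≤ 1 * fg (n + 5) := by omega
  have a3 : 2 * (0 : ℤ) + -fg (n + 3) ≤ -1 * fg (n + 3) := by omega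
  have a4 : 3 * (0 : ℤ) + -fg (n + 3) + -fg (n + 2) ≤ -1 * fg (n + 4) := by omega
  obtain ⟨R0, c0⟩ := TRel_count h0 0 _ _ 1 a1 a2
  obtain ⟨R1, c1⟩ := TRel_count h1 0 _ _ (-1) a3 a4
  obtain ⟨R2, c2⟩ := TRel_count h2 0 _ _ 1 a1 a2
  obtain ⟨R3, c3⟩ := TRel_count h3 0 _ _ (-1) a3 a4
  obtain ⟨R4, c4⟩ := TRel_count h4 0 _ _ 1 a1 a2
  rw [hmd, Bool.not_not] at c0 c2 c4
  have l1 : 3 * (fg (n + 2) : ℤ) + 1 ≤ 2 * fg (n + 3) := by omega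
  have l2 : 3 * (fg (n + 3) : ℤ) + 1 ≤ 2 * fg (n + 4) := by omega
  have l3 : (fg (n + 2) : ℤ) ≤ fg (n + 3) := by omega
  have l4 : (0 : ℤ) ≤ fg (n + 3) := by omega
  have l5 : (0 : ℤ) ≤ fg (n + 4) := by omega
  generalize (fg (n + 2) : ℤ) = b at *
  generalize (fg (n + 3) : ℤ) = c at *
  generalize (fg (n + 4) : ℤ) = d at *
  have final : ∀ L : ℕ, (L : ℤ) ≤ c * (2 * (R0 + R2 + R4) + 3 * (R1 + R3)) + R1 := by
    intro L
    have hL : (L : ℤ) = ∑ x ∈ Finset.Ico 0 (L : ℤ), (1 : ℤ) := by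
      rw [Finset.sum_const, Int.card_Ico, nsmul_eq_mul]; simp
    have key : c * (2 * (R0 + R2 + R4) + 3 * (R1 + R3)) + R1 ≥ _ :=
      add_le_add (mul_le_mul_of_nonneg_left (add_le_add
        (mul_le_mul_of_nonneg_left (add_le_add (add_le_add (c0 L) (c2 L)) (c4 L))
          (show (0 : ℤ) ≤ 2 by norm_num))
        (mul_le_mul_of_nonneg_left (add_le_add (c1 L) (c3 L)) (show (0 : ℤ) ≤ 3 by norm_num))) l4)
        (c1 L)
    refine le_trans (hL.le.trans ?_) key
    simp only [← Finset.sum_add_distrib, Finset.mul_sum]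
    apply Finset.sum_le_sum
    intro x _
    have k0 := (cntK_bd (!md n) w0 x).1
    have k1 := (cntK_bd (md n) w1 x).1
    have k2 := (cntK_bd (!md n) w2 x).1
    have k3 := (cntK_bd (md n) w3 x).1
    have k4 := (cntK_bd (!md n) w4 x).1
    have k5 := (cntK_bd (md n) w5 x).1
    have j0 := (cntH_bd (!md n) w0 x).1
    have j1 := (cntH_bd (md n) w1 x).1
    have j2 := (cntH_bd (!md n) w2 x).1
    have j3 := (cntH_bd (md n) w3 x).1
    have j4 := (cntH_bd (!md n) w4 x).1
    have j5 := (cntH_bd (md n) w5 x).1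
    generalize cntK (!md n) w0 x = K0 at *
    generalize cntK (md n) w1 x = K1 at *
    generalize cntK (!md n) w2 x = K2 at *
    generalize cntK (md n) w3 x = K3 at *
    generalize cntK (!md n) w4 x = K4 at *
    generalize cntK (md n) w5 x = K5 at *
    generalize cntH (!md n) w0 x = H0 at *
    generalize cntH (md n) w1 x = H1 at *
    generalize cntH (!md n) w2 x = H2 at *
    generalize cntH (md n) w3 x = H3 at *
    generalize cntH (!md n) w4 x = H4 at *
    generalize cntH (md n) w5 x = H5 at *
    have hd : 0 ≤ 2 * d - 3 * c - 1 := by omega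
    have hc : 0 ≤ 2 * c - 3 * b - 1 := by omega
    have S : K1 + K2 + H1 + H2 ≤ 2 * ((d * (K0 + K1) + c * (H0 + H1) - 1)
        + (d * (K2 + K3) + c * (H2 + H3) - 1) + (d * (K4 + K5) + c * (H4 + H5) - 1))
        + 3 * ((-c * (K1 + K2) + -b * (H1 + H2) + 1) + (-c * (K3 + K4) + -b * (H3 + H4) + 1)) := by
      have t1 := mul_nonneg hd (add_nonneg (add_nonneg k1 k2) (add_nonneg k3 k4))
      have t2 := mul_nonneg hc (add_nonneg (add_nonneg j1 j2) (add_nonneg j3 j4))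
      have t3 := mul_nonneg l5 (add_nonneg k0 k5)
      have t4 := mul_nonneg l4 (add_nonneg j0 j5)
      linarith
    have S2 := mul_le_mul_of_nonneg_left S l4
    have S3 := mul_nonneg (sub_nonneg.2 l3) (add_nonneg j1 j2)
    linarith
  have := final ((c * (2 * (R0 + R2 + R4) + 3 * (R1 + R3)) + R1 + 1).toNat)
  omega

/-- if a biinfinite sequence of biinfinite binary words `W` is such that
consecutive words are related by transducers `T_{v i}` with labels
`v i ∈ {n, n+1, n+2}`, then (i) every occurrence of `T_n` is bordered above and below by
`T_{n+1}`, and (ii) the pattern `T_{n+1} T_n T_{n+1} T_n T_{n+1}` never occurs.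
(Consequently every block `T_{n+1} T_n T_{n+1}` can be replaced by `T_{n+3}`, rewriting
the sequence as a composition of `T_{n+1}`, `T_{n+2}`, `T_{n+3}` only.) -/
theorem TRel_sequence_structure (n : ℕ) (W : ℤ → ℤ → Fin 2) (v : ℤ → ℕ)
    (hv : ∀ i : ℤ, v i = n ∨ v i = n + 1 ∨ v i = n + 2)
    (hrun : ∀ i : ℤ, TRel (v i) (W i) (W (i + 1))) :
    (∀ i : ℤ, v i = n → v (i - 1) = n + 1 ∧ v (i + 1) = n + 1) ∧
    ¬ ∃ i : ℤ, v i = n + 1 ∧ v (i + 1) = n ∧ v (i + 2) = n + 1 ∧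
      v (i + 3) = n ∧ v (i + 4) = n + 1 := by
  constructor
  · intro i hi
    constructor
    · have h1 := hrun (i - 1)
      rw [sub_add_cancel] at h1
      rcases hv (i - 1) with h | h | h
      · exact (parity_obstruct (by rw [h, hi]) h1 (hrun i)).elim
      · exact h
      · exact (parity_obstruct (by rw [h, hi]; omega) h1 (hrun i)).elim
    · rcases hv (i + 1) with h | h | h
      · exact (parity_obstruct (by rw [h, hi]) (hrun i) (hrun (i + 1))).elim
      · exact h
      · exact (parity_obstruct (by rw [h, hi]; omega) (hrun i) (hrun (i + 1))).elim
  · rintro ⟨i, e0, e1, e2, e3, e4⟩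
    have h0 := hrun i
    have h1 := hrun (i + 1)
    have h2 := hrun (i + 2)
    have h3 := hrun (i + 3)
    have h4 := hrun (i + 4)
    rw [e0] at h0
    rw [e1, show i + 1 + 1 = i + 2 by ring] at h1
    rw [e2, show i + 2 + 1 = i + 3 by ring] at h2
    rw [e3, show i + 3 + 1 = i + 4 by ring] at h3
    rw [e4] at h4
    exact pattern_obstruct h0 h1 h2 h3 h4
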